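/- Suppose x_B := ess sup B < ∞, q := P(B = x_B) ∈ (0,1), and P(0 < B < x_B) > 0. Let B_1 have the law of B conditioned on {B < x_B}, let Ψ_1(s) (for s ∈ [0,γ_w]) be the unique u ≥ 0 with Φ_A(−u)·((1−q)·Φ_{B_1}(s) + q) = 1, and let γ_v := sup_{s ∈ [0,γ_w]} (s − Ψ_1(s)) (the decay rate of the SRPT sojourn time). Then γ_p < γ_v < γ_w. -/

import Mathlib

open MeasureTheory ProbabilityTheory Filter
open scoped ENNReal

/-- The (extended-real-valued) moment generating function `Φ_X(s) = E[e^{sX}]`. -/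
noncomputable def emgf {Ω : Type*} [MeasurableSpace Ω] (μ : Measure Ω) (X : Ω → ℝ) (s : ℝ) :
    ℝ≥0∞ :=
  ∫⁻ ω, ENNReal.ofReal (Real.exp (s * X ω)) ∂μ

theorem abs_exp_sub_one_le_of_le {y c : ℝ} (hc : 0 ≤ c) (hy : y ≤ c) :
    |Real.exp y - 1| ≤ |y| * Real.exp c := by
  have hc1 : 1 ≤ Real.exp c := Real.one_le_exp hc
  rcases le_total 0 y with h | h
  · rw [abs_of_nonneg (by linarith [Real.one_le_exp h]), abs_of_nonneg h]
    have h1 := Real.add_one_le_exp (-y)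
    have h2 : Real.exp (-y) * Real.exp y = 1 := by rw [← Real.exp_add]; simp
    have h3 : Real.exp y ≤ Real.exp c := Real.exp_le_exp.2 hy
    have h4 := mul_le_mul_of_nonneg_right h1 (Real.exp_pos y).le
    have h5 := mul_le_mul_of_nonneg_left h3 h
    linarith
  · rw [abs_of_nonpos (by linarith [Real.exp_le_one_iff.2 h]), abs_of_nonpos h]
    nlinarith [Real.add_one_le_exp y]

theorem integral_lt_integral_of_ae_le_of_measure_pos {α : Type*} [MeasurableSpace α]
    {μ : Measure α} {f g : α → ℝ} (hf : Integrable f μ) (hg : Integrable g μ)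
    (hle : f ≤ᵐ[μ] g) (hlt : 0 < μ {x | f x < g x}) : ∫ x, f x ∂μ < ∫ x, g x ∂μ := by
  rw [← sub_pos, ← integral_sub hg hf, integral_pos_iff_support_of_nonneg_ae]
  · refine hlt.trans_le (measure_mono fun x hx => ?_)
    exact (sub_pos.2 hx).ne'
  · filter_upwards [hle] with x hx using sub_nonneg.2 hx
  · exact hg.sub hf

section MomentGeneratingFunction

variable {Ω : Type*} [MeasurableSpace Ω] {μ : Measure Ω} {X : Ω → ℝ} {c : ℝ}

theorem integrable_exp_mul_of_ae_le_const [IsFiniteMeasure μ] (hX : AEMeasurable X μ)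
    (hc : ∀ᵐ ω ∂μ, X ω ≤ c) {s : ℝ} (hs : 0 ≤ s) :
    Integrable (fun ω => Real.exp (s * X ω)) μ := by
  refine Integrable.of_bound (C := Real.exp (s * c))
    (Real.measurable_exp.comp_aemeasurable (hX.const_mul s)).aestronglyMeasurable ?_
  filter_upwards [hc] with ω hω
  rw [Real.norm_eq_abs, abs_of_pos (Real.exp_pos _)]
  exact Real.exp_le_exp.2 (mul_le_mul_of_nonneg_left hω hs)

theorem emgf_eq_ofReal_mgf {s : ℝ} (h : Integrable (fun ω => Real.exp (s * X ω)) μ) :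
    emgf μ X s = ENNReal.ofReal (mgf X μ s) :=
  (ofReal_integral_eq_lintegral_ofReal h (ae_of_all _ fun _ => (Real.exp_pos _).le)).symm

theorem exists_pos_mgf_le_one [IsProbabilityMeasure μ] (hX : Integrable X μ)
    (hc : ∀ᵐ ω ∂μ, X ω ≤ c) (hneg : ∫ ω, X ω ∂μ < 0) : ∃ s > 0, mgf X μ s ≤ 1 := by
  have hlim : Tendsto (fun s : ℝ => ∫ ω, (Real.exp (s * X ω) - 1) / s ∂μ)
      (nhdsWithin 0 (Set.Ioi 0)) (nhds (∫ ω, X ω ∂μ)) := by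
    refine tendsto_integral_filter_of_dominated_convergence
      (fun ω => |X ω| * Real.exp |c|) ?_ ?_ (hX.abs.mul_const _) ?_
    · filter_upwards with s
      exact (((Real.measurable_exp.comp_aemeasurable
        (hX.aemeasurable.const_mul s)).sub_const 1).div_const s).aestronglyMeasurable
    · filter_upwards [Ioo_mem_nhdsGT (zero_lt_one (α := ℝ))] with s hs
      filter_upwards [hc] with ω hω
      have hle : s * X ω ≤ |c| := by
        have h1 : X ω ≤ |c| := hω.trans (le_abs_self c)
        nlinarith [abs_nonneg c, hs.1, hs.2]
      have h := abs_exp_sub_one_le_of_le (abs_nonneg c) hle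
      rw [Real.norm_eq_abs, abs_div, abs_of_pos hs.1, div_le_iff₀ hs.1]
      rw [abs_mul, abs_of_pos hs.1] at h
      linarith
    · filter_upwards with ω
      have hd : HasDerivAt (fun s : ℝ => Real.exp (s * X ω)) (X ω) 0 := by
        simpa using ((hasDerivAt_id (0 : ℝ)).mul_const (X ω)).exp
      have ht := hd.tendsto_slope_zero_right
      refine ht.congr fun s => ?_
      simp [div_eq_inv_mul]
  obtain ⟨s, hs, hspos⟩ := ((hlim.eventually (gt_mem_nhds hneg)).and self_mem_nhdsWithin).exists
  refine ⟨s, hspos, ?_⟩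
  have hspos' : 0 < s := hspos
  rw [integral_div, integral_sub (integrable_exp_mul_of_ae_le_const hX.aemeasurable hc hspos'.le)
    (integrable_const _)] at hs
  have h := (div_lt_iff₀ hspos').1 hs
  simp only [integral_const, probReal_univ, smul_eq_mul, mul_one, zero_mul] at h
  exact (sub_neg.1 h).le

theorem bddAbove_setOf_mgf_le_one [IsFiniteMeasure μ] (hX : AEMeasurable X μ)
    (hc : ∀ᵐ ω ∂μ, X ω ≤ c) (hpos : 0 < μ {ω | 0 < X ω}) :
    BddAbove {s : ℝ | 0 ≤ s ∧ mgf X μ s ≤ 1} := by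
  have hU : {ω | 0 < X ω} = ⋃ n : ℕ, {ω | 1 / ((n : ℝ) + 1) ≤ X ω} := by
    ext ω
    simp only [Set.mem_ofPred_eq, Set.mem_iUnion]
    constructor
    · intro h
      obtain ⟨n, hn⟩ := exists_nat_one_div_lt h
      exact ⟨n, hn.le⟩
    · rintro ⟨n, hn⟩
      exact lt_of_lt_of_le (by positivity) hn
  obtain ⟨n, hn⟩ := exists_measure_pos_of_not_measure_iUnion_null (hU ▸ hpos.ne')
  set δ : ℝ := 1 / ((n : ℝ) + 1) with hδ
  have hδ0 : 0 < δ := by positivity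
  have hp : 0 < μ.real {ω | δ ≤ X ω} := ENNReal.toReal_pos hn.ne' (measure_ne_top _ _)
  refine ⟨(-Real.log (μ.real {ω | δ ≤ X ω})) / δ, ?_⟩
  rintro s ⟨hs, hs1⟩
  have h := measure_ge_le_exp_mul_mgf δ hs (integrable_exp_mul_of_ae_le_const hX hc hs)
  have h2 : μ.real {ω | δ ≤ X ω} ≤ Real.exp (-s * δ) :=
    h.trans (mul_le_of_le_one_right (Real.exp_pos _).le hs1)
  have h3 := (Real.log_le_iff_le_exp hp).2 h2
  rw [le_div_iff₀ hδ0]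
  linarith

theorem mgf_sSup_le_one [IsProbabilityMeasure μ] (hX : Integrable X μ)
    (hc : ∀ᵐ ω ∂μ, X ω ≤ c) (hneg : ∫ ω, X ω ∂μ < 0) (hpos : 0 < μ {ω | 0 < X ω}) :
    0 < sSup {s : ℝ | 0 ≤ s ∧ mgf X μ s ≤ 1} ∧
      mgf X μ (sSup {s : ℝ | 0 ≤ s ∧ mgf X μ s ≤ 1}) ≤ 1 := by
  have hbdd := bddAbove_setOf_mgf_le_one hX.aemeasurable hc hpos
  obtain ⟨s₀, hs₀, hs₀1⟩ := exists_pos_mgf_le_one hX hc hneg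
  have hmem : s₀ ∈ {s : ℝ | 0 ≤ s ∧ mgf X μ s ≤ 1} := ⟨hs₀.le, hs₀1⟩
  have hsup : 0 < sSup {s : ℝ | 0 ≤ s ∧ mgf X μ s ≤ 1} := hs₀.trans_le (le_csSup hbdd hmem)
  refine ⟨hsup, ?_⟩
  have hcont : ContinuousAt (mgf X μ) (sSup {s : ℝ | 0 ≤ s ∧ mgf X μ s ≤ 1}) := by
    have hsub : Set.Ioi (0 : ℝ) ⊆ interior (integrableExpSet X μ) :=
      interior_maximal (fun s hs => integrable_exp_mul_of_ae_le_const hX.aemeasurable hc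
        (le_of_lt hs)) isOpen_Ioi
    exact continuousOn_mgf.continuousAt (isOpen_interior.mem_nhds (hsub hsup))
  have hcl := csSup_mem_closure ⟨s₀, hmem⟩ hbdd
  have := mem_closure_iff_frequently.1 hcl
  by_contra! hgt
  obtain ⟨s, hs, hs'⟩ := (this.and_eventually (hcont.eventually (lt_mem_nhds hgt))).exists
  exact (hs.2.trans_lt hs').false

theorem mgf_strictMonoOn_of_nonneg [IsFiniteMeasure μ] (hX : AEMeasurable X μ)
    (hc : ∀ᵐ ω ∂μ, X ω ≤ c) (hnonneg : ∀ᵐ ω ∂μ, 0 ≤ X ω) (hpos : 0 < μ {ω | 0 < X ω}) :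
    StrictMonoOn (mgf X μ) (Set.Ici 0) := by
  intro s hs t ht hst
  refine integral_lt_integral_of_ae_le_of_measure_pos
    (integrable_exp_mul_of_ae_le_const hX hc hs) (integrable_exp_mul_of_ae_le_const hX hc ht) ?_ ?_
  · filter_upwards [hnonneg] with ω hω
    exact Real.exp_le_exp.2 (mul_le_mul_of_nonneg_right hst.le hω)
  · refine hpos.trans_le (measure_mono fun ω hω => ?_)
    exact Real.exp_lt_exp.2 (mul_lt_mul_of_pos_right hst hω)

theorem mgf_neg_strictAntiOn_of_pos [IsProbabilityMeasure μ] (hX : AEMeasurable X μ)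
    (hpos : ∀ᵐ ω ∂μ, 0 < X ω) : StrictAntiOn (mgf (-X) μ) (Set.Ici 0) := by
  have hc : ∀ᵐ ω ∂μ, (-X) ω ≤ 0 := by
    filter_upwards [hpos] with ω hω using neg_nonpos.2 hω.le
  intro s hs t ht hst
  refine integral_lt_integral_of_ae_le_of_measure_pos
    (integrable_exp_mul_of_ae_le_const hX.neg hc ht)
    (integrable_exp_mul_of_ae_le_const hX.neg hc hs) ?_ ?_
  · filter_upwards [hc] with ω hω
    exact Real.exp_le_exp.2 (mul_le_mul_of_nonpos_right hst.le hω)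
  · have h1 : μ {ω | 0 < X ω} = 1 := by
      rw [measure_congr (eventuallyEq_univ.2 hpos), measure_univ]
    refine (h1 ▸ zero_lt_one).trans_le (measure_mono fun ω hω => ?_)
    exact Real.exp_lt_exp.2 (mul_lt_mul_of_neg_right hst (neg_neg_of_pos hω))

theorem mgf_neg_sub_le [IsFiniteMeasure μ] (hX : Integrable X μ)
    (hnonneg : ∀ᵐ ω ∂μ, 0 ≤ X ω) {u v : ℝ} (hu : 0 ≤ u) (huv : u ≤ v) :
    mgf (-X) μ u - mgf (-X) μ v ≤ (∫ ω, X ω ∂μ) * (v - u) := by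
  have hc : ∀ᵐ ω ∂μ, (-X) ω ≤ 0 := by
    filter_upwards [hnonneg] with ω hω using neg_nonpos.2 hω
  have hiu := integrable_exp_mul_of_ae_le_const hX.aemeasurable.neg hc hu
  have hiv := integrable_exp_mul_of_ae_le_const hX.aemeasurable.neg hc (hu.trans huv)
  rw [mgf, mgf, ← integral_sub hiu hiv, ← integral_mul_const]
  refine integral_mono_ae (hiu.sub hiv) (hX.mul_const _) ?_
  filter_upwards [hnonneg] with ω hω
  have h1 := Real.add_one_le_exp (-((v - u) * X ω))
  have h2 : Real.exp (v * (-X) ω) = Real.exp (u * (-X) ω) * Real.exp (-((v - u) * X ω)) := by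
    rw [← Real.exp_add]; congr 1; simp only [Pi.neg_apply]; ring
  have h3 : Real.exp (u * (-X) ω) ≤ 1 :=
    Real.exp_le_one_iff.2 (mul_nonpos_of_nonneg_of_nonpos hu (neg_nonpos.2 hω))
  have h4 := Real.exp_pos (u * (-X) ω)
  have h5 : 0 ≤ (v - u) * X ω := mul_nonneg (sub_nonneg.2 huv) hω
  show Real.exp (u * (-X) ω) - Real.exp (v * (-X) ω) ≤ X ω * (v - u)
  rw [h2]
  nlinarith

theorem mgf_eq_mgf_restrict_add [IsFiniteMeasure μ] {x : ℝ} (hX : Measurable X)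
    (hx : ∀ᵐ ω ∂μ, X ω ≤ x) {s : ℝ} (hs : 0 ≤ s) :
    mgf X μ s =
      mgf X (μ.restrict {ω | X ω < x}) s + μ.real {ω | X ω = x} * Real.exp (s * x) := by
  have hS : MeasurableSet {ω | X ω < x} := measurableSet_lt hX measurable_const
  have hcompl : ({ω | X ω < x}ᶜ : Set Ω) =ᵐ[μ] {ω | X ω = x} := by
    filter_upwards [hx] with ω hω
    refine propext ?_
    change ¬ X ω < x ↔ X ω = x
    exact ⟨fun h => le_antisymm hω (not_lt.1 h), fun h => h.not_lt⟩
  have hE : MeasurableSet {ω | X ω = x} := measurableSet_eq_fun hX measurable_const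
  rw [mgf, ← integral_add_compl hS (integrable_exp_mul_of_ae_le_const hX.aemeasurable hx hs),
    setIntegral_congr_set hcompl, setIntegral_congr_fun (g := fun _ => Real.exp (s * x)) hE]
  · simp [mgf]
  · intro ω hω
    change Real.exp (s * X ω) = _
    rw [show X ω = x from hω]

end MomentGeneratingFunction

/-- The strict comparison of decay rates, for the inter-arrival transform `a`, the service-time
transform `b` and the transform `b₁` of the service times below the maximal size. -/
theorem sSup_sub_lt_sSup_sub_and_lt {a b b₁ Ψ Ψ₁ : ℝ → ℝ} {w L : ℝ} (hw : 0 < w) (hL : 0 < L)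
    (ha : StrictAntiOn a (Set.Ici 0)) (ha0 : a 0 = 1)
    (hLip : ∀ u v, 0 ≤ u → u ≤ v → a u - a v ≤ L * (v - u))
    (hb : MonotoneOn b (Set.Ici 0)) (hb₁ : MonotoneOn b₁ (Set.Ici 0))
    (hb₁pos : ∀ s, 0 < s → 1 < b₁ s)
    (hgap : ∀ ε > 0, ∃ c > 0, ∀ s, ε ≤ s → b₁ s + c ≤ b s)
    (hΨ : ∀ s, 0 ≤ s → 0 ≤ Ψ s ∧ a (Ψ s) * b s = 1)
    (hΨ₁ : ∀ s, 0 ≤ s → s ≤ w → 0 ≤ Ψ₁ s ∧ a (Ψ₁ s) * b₁ s = 1)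
    (hle : a w * b w ≤ 1) (hgt : ∀ s, w < s → 1 < a s * b s) :
    sSup {x : ℝ | ∃ s, 0 ≤ s ∧ x = s - Ψ s} < sSup {x : ℝ | ∃ s, 0 ≤ s ∧ s ≤ w ∧ x = s - Ψ₁ s} ∧
      sSup {x : ℝ | ∃ s, 0 ≤ s ∧ s ≤ w ∧ x = s - Ψ₁ s} < w := by
  have hbpos : ∀ s, 0 < s → 1 < b s := by
    intro s hs
    obtain ⟨c, hc, h⟩ := hgap s hs
    linarith [h s le_rfl, hb₁pos s hs]
  have hdiff : ∀ ε > 0, ∃ d > 0, ∀ s, ε ≤ s → s ≤ w → Ψ₁ s + d ≤ Ψ s := by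
    intro ε hε
    obtain ⟨c, hc, h⟩ := hgap ε hε
    have hM : 0 < b w := by linarith [hbpos w hw]
    refine ⟨c / b w ^ 2 / L, by positivity, fun s hs hsw => ?_⟩
    have hs0 : 0 < s := hε.trans_le hs
    obtain ⟨h0, h1⟩ := hΨ s hs0.le
    obtain ⟨h0', h1'⟩ := hΨ₁ s hs0.le hsw
    have hb1 := hb₁pos s hs0
    have hbs := hbpos s hs0
    have hgs := h s hs
    have hbw : b s ≤ b w := hb hs0.le hw.le hsw
    have key : c / b w ^ 2 ≤ a (Ψ₁ s) - a (Ψ s) := by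
      rw [eq_div_of_mul_eq (by linarith) h1, eq_div_of_mul_eq (by linarith) h1',
        div_sub_div _ _ (by linarith) (by linarith)]
      have hden : b₁ s * b s ≤ b w ^ 2 := by nlinarith
      have : 0 < b₁ s * b s := by positivity
      apply div_le_div₀ <;> linarith
    have hcp : 0 < c / b w ^ 2 := by positivity
    have hlt : Ψ₁ s < Ψ s := by
      by_contra! hcon
      linarith [ha.antitoneOn h0 h0' hcon]
    have h3 := hLip _ _ h0' hlt.le
    have : c / b w ^ 2 / L ≤ Ψ s - Ψ₁ s := by
      rw [div_le_iff₀ hL]; linarith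
    linarith
  have hne : {x : ℝ | ∃ s, 0 ≤ s ∧ s ≤ w ∧ x = s - Ψ₁ s}.Nonempty := ⟨_, 0, le_rfl, hw.le, rfl⟩
  have hbdd : BddAbove {x : ℝ | ∃ s, 0 ≤ s ∧ s ≤ w ∧ x = s - Ψ₁ s} := by
    refine ⟨w, ?_⟩
    rintro x ⟨s, hs, hsw, rfl⟩
    linarith [(hΨ₁ s hs hsw).1]
  set v := sSup {x : ℝ | ∃ s, 0 ≤ s ∧ s ≤ w ∧ x = s - Ψ₁ s} with hv
  have hvle : ∀ s, 0 ≤ s → s ≤ w → s - Ψ₁ s ≤ v := fun s hs hsw =>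
    le_csSup hbdd ⟨s, hs, hsw, rfl⟩
  constructor
  · have hΨw : Ψ w ≤ w := by
      by_contra! hcon
      have h1 := ha hw.le (hΨ w hw.le).1 hcon
      have h2 := (hΨ w hw.le).2
      nlinarith [hbpos w hw]
    have hv0 : 0 < v := by
      obtain ⟨d, hd, h⟩ := hdiff w hw
      linarith [h w le_rfl le_rfl, hvle w hw.le le_rfl]
    obtain ⟨d, hd, h⟩ := hdiff (v / 2) (by positivity)
    have hmax : max (v / 2) (v - d) < v := max_lt (by linarith) (by linarith)
    refine lt_of_le_of_lt (csSup_le ⟨_, 0, le_rfl, rfl⟩ ?_) hmax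
    rintro x ⟨s, hs, rfl⟩
    obtain ⟨h0, h1⟩ := hΨ s hs
    rcases lt_or_ge s (v / 2) with hsv | hsv
    · exact le_max_of_le_left (by linarith)
    rcases le_or_gt s w with hsw | hsw
    · exact le_max_of_le_right (by linarith [h s hsv hsw, hvle s hs hsw])
    · have h2 : s < Ψ s := by
        by_contra! hcon
        have h3 := ha.antitoneOn h0 hs hcon
        nlinarith [hgt s hsw, hbpos s (hw.trans hsw)]
      exact le_max_of_le_left (by linarith)
  · have hw2 : 0 < w / 2 := by positivity
    obtain ⟨h0, h1⟩ := hΨ₁ (w / 2) hw2.le (by linarith)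
    have hpos : 0 < Ψ₁ (w / 2) := by
      refine h0.lt_of_ne fun h => ?_
      rw [← h, ha0] at h1
      linarith [hb₁pos _ hw2]
    have hmax : max (w / 2) (w - Ψ₁ (w / 2)) < w := max_lt (by linarith) (by linarith)
    refine lt_of_le_of_lt (csSup_le hne ?_) hmax
    rintro x ⟨s, hs, hsw, rfl⟩
    obtain ⟨h0', h1'⟩ := hΨ₁ s hs hsw
    rcases lt_or_ge s (w / 2) with hs2 | hs2
    · exact le_max_of_le_left (by linarith)
    · have h2 : Ψ₁ (w / 2) ≤ Ψ₁ s := by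
        by_contra! hcon
        have h3 := ha h0' h0 hcon
        have h4 := hb₁ hw2.le hs hs2
        have h5 := hb₁pos _ hw2
        have h6 : 0 < a (Ψ₁ (w / 2)) := pos_of_mul_pos_left (h1 ▸ one_pos) (by linarith)
        nlinarith
      exact le_max_of_le_right (by linarith)

/-- Suppose `x_B = ess sup B < ∞`, `q = P(B = x_B) ∈ (0,1)`, and
`P(0 < B < x_B) > 0`. With `B_1` distributed as `B` conditioned on `{B < x_B}`,
`Ψ_1(s)` the unique `u ≥ 0` with `Φ_A(-u) ((1-q) Φ_{B_1}(s) + q) = 1`, and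
`γ_v = sup_{s ∈ [0,γ_w]} (s - Ψ_1(s))` (the SRPT sojourn-time decay rate),
one has `γ_p < γ_v < γ_w`. -/
theorem srpt_decay_rate_strictly_in_between
    {Ω : Type*} [MeasurableSpace Ω] (μ : Measure Ω) [IsProbabilityMeasure μ]
    (A B : Ω → ℝ)
    (hAmeas : Measurable A) (hBmeas : Measurable B)
    (hindep : IndepFun A B μ)
    (hApos : ∀ᵐ ω ∂μ, 0 < A ω)
    (hAint : Integrable A μ)
    (hBnonneg : ∀ᵐ ω ∂μ, 0 ≤ B ω)
    (hBint : Integrable B μ)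
    (hstable : ∫ ω, B ω ∂μ < ∫ ω, A ω ∂μ)
    (hBA : 0 < μ {ω | A ω < B ω})
    (hlight : ∃ s > 0, emgf μ B s < ⊤)
    -- `x_B` is the (finite) right endpoint of the service-time distribution, carrying
    -- mass `q ∈ (0,1)`, and `P(0 < B < x_B) > 0`
    (xB : ℝ) (hxB : xB = essSup B μ)
    (hBle : ∀ᵐ ω ∂μ, B ω ≤ xB)
    (q : ℝ) (hq : q = (μ {ω | B ω = xB}).toReal)
    (hq01 : 0 < q ∧ q < 1)
    (hmid : 0 < μ {ω | 0 < B ω ∧ B ω < xB})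
    -- `Φ_{B_1}` is the mgf of `B` conditioned on `{B < x_B}` (the class-1 service time)
    (ΦB1 : ℝ → ℝ≥0∞)
    (hΦB1 : ∀ s, ΦB1 s =
      ∫⁻ ω, ENNReal.ofReal (Real.exp (s * B ω)) ∂(ProbabilityTheory.cond μ {ω | B ω < xB}))
    -- the workload decay rate
    (γw : ℝ)
    (hγw : γw = sSup {s : ℝ | 0 ≤ s ∧ emgf μ A (-s) * emgf μ B s ≤ 1})
    -- `Ψ(s)` is the unique `u ≥ 0` with `Φ_A(-u) Φ_B(s) = 1`; `γ_p` the busy-period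
    -- decay rate
    (Ψ : ℝ → ℝ)
    (hΨ : ∀ s, 0 ≤ s → emgf μ B s < ⊤ →
      0 ≤ Ψ s ∧ emgf μ A (-(Ψ s)) * emgf μ B s = 1)
    (γp : ℝ)
    (hγp : γp = sSup {x : ℝ | ∃ s, 0 ≤ s ∧ emgf μ B s < ⊤ ∧ x = s - Ψ s})
    -- `Ψ_1(s)` is the unique `u ≥ 0` with `Φ_A(-u) ((1-q) Φ_{B_1}(s) + q) = 1`
    (Ψ1 : ℝ → ℝ)
    (hΨ1 : ∀ s, 0 ≤ s → s ≤ γw →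
      0 ≤ Ψ1 s ∧
        emgf μ A (-(Ψ1 s)) * (ENNReal.ofReal (1 - q) * ΦB1 s + ENNReal.ofReal q) = 1)
    -- `γ_v` is the decay rate of the SRPT sojourn time
    (γv : ℝ)
    (hγv : γv = sSup {x : ℝ | ∃ s, 0 ≤ s ∧ s ≤ γw ∧ x = s - Ψ1 s}) :
    γp < γv ∧ γv < γw := by
  have hnegA : ∀ᵐ ω ∂μ, (-A) ω ≤ 0 := by
    filter_upwards [hApos] with ω hω using neg_nonpos.2 hω.le
  have hEA : 0 < ∫ ω, A ω ∂μ := (integral_nonneg_of_ae hBnonneg).trans_lt hstable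
  have hxB0 : 0 < xB := by
    obtain ⟨ω, hω⟩ := nonempty_of_measure_ne_zero hmid.ne'
    exact hω.1.trans hω.2
  have hiB : ∀ s, 0 ≤ s → Integrable (fun ω => Real.exp (s * B ω)) μ := fun s hs =>
    integrable_exp_mul_of_ae_le_const hBmeas.aemeasurable hBle hs
  have heB : ∀ s, 0 ≤ s → emgf μ B s = ENNReal.ofReal (mgf B μ s) := fun s hs =>
    emgf_eq_ofReal_mgf (hiB s hs)
  have heA : ∀ s, 0 ≤ s → emgf μ A (-s) = ENNReal.ofReal (mgf (-A) μ s) := by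
    intro s hs
    rw [mgf_neg]
    refine emgf_eq_ofReal_mgf ?_
    simpa using integrable_exp_mul_of_ae_le_const hAmeas.aemeasurable.neg hnegA hs
  have hmgfsum : ∀ s, mgf (-A + B) μ s = mgf (-A) μ s * mgf B μ s := fun s =>
    hindep.neg_left.mgf_add' hAmeas.neg.aestronglyMeasurable hBmeas.aestronglyMeasurable
  have hnn : ∀ {X : Ω → ℝ} {s : ℝ}, 0 ≤ mgf X μ s := mgf_nonneg
  have hwset : {s : ℝ | 0 ≤ s ∧ emgf μ A (-s) * emgf μ B s ≤ 1} =
      {s : ℝ | 0 ≤ s ∧ mgf (-A + B) μ s ≤ 1} := by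
    ext s
    refine and_congr_right fun hs => ?_
    rw [heA s hs, heB s hs, ← ENNReal.ofReal_mul hnn, hmgfsum, ENNReal.ofReal_le_one]
  have hXle : ∀ᵐ ω ∂μ, (-A + B) ω ≤ xB := by
    filter_upwards [hBle, hApos] with ω h1 h2
    simp only [Pi.add_apply, Pi.neg_apply]
    linarith
  have hXint : Integrable (-A + B) μ := hAint.neg.add hBint
  have hXneg : ∫ ω, (-A + B) ω ∂μ < 0 := by
    rw [integral_add' hAint.neg hBint, integral_neg']
    linarith
  have hXpos : 0 < μ {ω | 0 < (-A + B) ω} := by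
    refine hBA.trans_le (measure_mono fun ω hω => ?_)
    have : A ω < B ω := hω
    simp only [Set.mem_ofPred_eq, Pi.add_apply, Pi.neg_apply]
    linarith
  rw [hwset] at hγw
  have hbdd := bddAbove_setOf_mgf_le_one hXint.aemeasurable hXle hXpos
  obtain ⟨hw, hwle⟩ := mgf_sSup_le_one hXint hXle hXneg hXpos
  rw [← hγw] at hw hwle
  have hS : MeasurableSet {ω | B ω < xB} := measurableSet_lt hBmeas measurable_const
  have hqreal : μ.real {ω | B ω = xB} = q := hq.symm
  have hdecomp : ∀ s, 0 ≤ s →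
      mgf B μ s = mgf B (μ.restrict {ω | B ω < xB}) s + q * Real.exp (s * xB) := by
    intro s hs
    rw [mgf_eq_mgf_restrict_add hBmeas hBle hs, hqreal]
  have hmass : μ.real {ω | B ω < xB} = 1 - q := by
    have h := hdecomp 0 le_rfl
    simp only [mgf_zero, mgf_zero', zero_mul, Real.exp_zero, mul_one,
      measureReal_restrict_apply_univ] at h
    linarith
  have hmono : StrictMonoOn (mgf B (μ.restrict {ω | B ω < xB})) (Set.Ici 0) := by
    refine mgf_strictMonoOn_of_nonneg hBmeas.aemeasurable (ae_restrict_of_ae hBle)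
      (ae_restrict_of_ae hBnonneg) ?_
    rw [Measure.restrict_apply' hS]
    exact hmid
  have hclass : ∀ s, 0 ≤ s → ENNReal.ofReal (1 - q) * ΦB1 s + ENNReal.ofReal q =
      ENNReal.ofReal (mgf B (μ.restrict {ω | B ω < xB}) s + q) := by
    intro s hs
    have hμS : ENNReal.ofReal (1 - q) = μ {ω | B ω < xB} := by
      rw [← hmass, ofReal_measureReal]
    have hμS0 : μ {ω | B ω < xB} ≠ 0 :=
      (hmid.trans_le (measure_mono fun ω hω => hω.2)).ne'
    rw [hΦB1, ProbabilityTheory.cond, lintegral_smul_measure, smul_eq_mul, hμS, ← mul_assoc,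
      ENNReal.mul_inv_cancel hμS0 (measure_ne_top _ _), one_mul,
      ENNReal.ofReal_add mgf_nonneg hq01.1.le]
    congr 1
    exact emgf_eq_ofReal_mgf (hiB s hs).integrableOn
  have hpset : {x : ℝ | ∃ s, 0 ≤ s ∧ emgf μ B s < ⊤ ∧ x = s - Ψ s} =
      {x : ℝ | ∃ s, 0 ≤ s ∧ x = s - Ψ s} := by
    ext x
    refine exists_congr fun s => and_congr_right fun hs => ?_
    simp [heB s hs]
  rw [hγp, hγv, hpset]
  refine sSup_sub_lt_sSup_sub_and_lt (a := mgf (-A) μ) (b := mgf B μ)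
    (b₁ := fun s => mgf B (μ.restrict {ω | B ω < xB}) s + q) hw hEA
    (mgf_neg_strictAntiOn_of_pos hAmeas.aemeasurable hApos) mgf_zero ?_ ?_ ?_ ?_ ?_ ?_ ?_ ?_ ?_
  · intro u v hu huv
    exact mgf_neg_sub_le hAint (by filter_upwards [hApos] with ω hω using hω.le) hu huv
  · intro s hs t ht hst
    have h1 := hmono.monotoneOn hs ht hst
    have h2 : Real.exp (s * xB) ≤ Real.exp (t * xB) :=
      Real.exp_le_exp.2 (mul_le_mul_of_nonneg_right hst hxB0.le)
    rw [hdecomp s hs, hdecomp t ht]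
    nlinarith [hq01.1]
  · intro s hs t ht hst
    have h1 := hmono.monotoneOn hs ht hst
    change _ + q ≤ _ + q
    linarith
  · intro s hs
    have h1 := hmono (Set.self_mem_Ici) hs.le hs
    rw [mgf_zero', measureReal_restrict_apply_univ, hmass] at h1
    change 1 < _ + q
    linarith
  · intro ε hε
    refine ⟨q * (Real.exp (ε * xB) - 1),
      mul_pos hq01.1 (sub_pos.2 (Real.one_lt_exp_iff.2 (mul_pos hε hxB0))), fun s hs => ?_⟩
    have h2 : Real.exp (ε * xB) ≤ Real.exp (s * xB) :=
      Real.exp_le_exp.2 (mul_le_mul_of_nonneg_right hs hxB0.le)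
    rw [hdecomp s (hε.le.trans hs)]
    nlinarith [hq01.1]
  · intro s hs
    obtain ⟨h0, h1⟩ := hΨ s hs (by simp [heB s hs])
    rw [heA _ h0, heB s hs, ← ENNReal.ofReal_mul hnn, ENNReal.ofReal_eq_one] at h1
    exact ⟨h0, h1⟩
  · intro s hs hsw
    obtain ⟨h0, h1⟩ := hΨ1 s hs hsw
    rw [heA _ h0, hclass s hs, ← ENNReal.ofReal_mul hnn, ENNReal.ofReal_eq_one] at h1
    exact ⟨h0, h1⟩
  · rw [← hmgfsum]
    exact hwle
  · intro s hs
    rw [← hmgfsum]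
    by_contra! hcon
    have := le_csSup hbdd ⟨hw.le.trans hs.le, hcon⟩
    rw [← hγw] at this
    linarith
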